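/- Suppose x, y ∈ Y^ℕ agree on all coordinates except i and j, with x(i) < y(i) < y(j) < x(j) in the linear order of Y. Then for every n > max(i,j), the sorted initial segment x_[n] is strictly lexicographically less than y_[n]. -/

import Mathlib

/-- The first `n` coordinates of `z`, sorted in nondecreasing order. -/
noncomputable def sortedSeg {Y : Type*} [LinearOrder Y] (z : ℕ → Y) (n : ℕ) : List Y :=
  (List.ofFn fun i : Fin n => z i).insertionSort (· ≤ ·)

/-- Lexicographic comparison of lists (of equal length). -/
def listLexLE {Y : Type*} [LinearOrder Y] (l₁ l₂ : List Y) : Prop :=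
  List.Lex (· < ·) l₁ l₂ ∨ l₁ = l₂

theorem lex_aux {Y : Type*} [LinearOrder Y] (a : Y) : ∀ l₁ l₂ : List Y,
    l₁.Pairwise (· ≤ ·) → l₂.Pairwise (· ≤ ·) → l₁.length = l₂.length →
    (∀ b, b < a → l₁.count b = l₂.count b) → l₂.count a < l₁.count a →
    List.Lex (· < ·) l₁ l₂
  | [], _, _, _, _, _, h => by simp at h
  | _ :: _, [], _, _, h, _, _ => by simp at h
  | c :: t, d :: u, s1, s2, hl, hb, ha => by
    have hca : c ≤ a := by
      have hm : a ∈ c :: t := List.count_pos_iff.1 (by omega)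
      rcases List.mem_cons.1 hm with h | h
      · exact h.ge
      · exact (List.pairwise_cons.1 s1).1 a h
    rcases lt_trichotomy c d with h | h | h
    · exact List.Lex.rel h
    · subst h
      refine List.Lex.cons (lex_aux a t u (List.pairwise_cons.1 s1).2
        (List.pairwise_cons.1 s2).2 (by simpa using hl) ?_ ?_)
      · intro b hba
        have := hb b hba
        simp only [List.count_cons] at this
        omega
      · simp only [List.count_cons] at ha
        omega
    · exfalso
      have h0 := hb d (h.trans_le hca)
      have hm : d ∈ c :: t := List.count_pos_iff.1 (by
        rw [h0]; exact List.count_pos_iff.2 List.mem_cons_self)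
      rcases List.mem_cons.1 hm with h' | h'
      · exact h.ne h'
      · exact absurd ((List.pairwise_cons.1 s1).1 d h') (not_le.2 h)

theorem count_sortedSeg {Y : Type*} [LinearOrder Y] (z : ℕ → Y) (n : ℕ) (b : Y) :
    (sortedSeg z n).count b = ((Finset.range n).filter (fun k => z k = b)).card := by
  unfold sortedSeg
  rw [(List.perm_insertionSort _ _).count_eq]
  induction n with
  | zero => simp
  | succ n ih =>
    rw [List.ofFn_succ', List.concat_eq_append, List.count_append, Finset.range_add_one,
      Finset.filter_insert]
    simp only [Fin.val_castSucc, Fin.val_last]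
    rw [ih]
    by_cases h : z n = b <;> simp [h]


/-- If `x` and `y` agree off `{i,j}` and `x i < y i < y j < x j`, then for every
`n > max i j` the sorted initial segment of `x` is strictly lexicographically
below that of `y`. -/
theorem sea_stmt_7 (Y : Type*) [LinearOrder Y] (x y : ℕ → Y) (i j : ℕ)
    (hagree : ∀ k, k ≠ i → k ≠ j → x k = y k)
    (h1 : x i < y i) (h2 : y i < y j) (h3 : y j < x j) :
    ∀ n, n > max i j → List.Lex (· < ·) (sortedSeg x n) (sortedSeg y n) := by
  intro n hn
  have hi : i < n := lt_of_le_of_lt (le_max_left _ _) hn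
  apply lex_aux (x i)
  · exact List.pairwise_insertionSort _ _
  · exact List.pairwise_insertionSort _ _
  · simp [sortedSeg]
  · intro b hb
    rw [count_sortedSeg, count_sortedSeg]
    congr 1
    ext k
    simp only [Finset.mem_filter, Finset.mem_range]
    refine and_congr_right fun _ => ?_
    by_cases hki : k = i
    · subst hki
      exact iff_of_false hb.ne' (hb.trans h1).ne'
    by_cases hkj : k = j
    · subst hkj
      exact iff_of_false (hb.trans (h1.trans (h2.trans h3))).ne' (hb.trans (h1.trans h2)).ne'
    rw [hagree k hki hkj]
  · rw [count_sortedSeg, count_sortedSeg]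
    apply Finset.card_lt_card
    rw [Finset.ssubset_iff_of_subset]
    · exact ⟨i, by simp [hi], by simp [h1.ne']⟩
    · intro k
      simp only [Finset.mem_filter, Finset.mem_range]
      rintro ⟨hk, hy⟩
      refine ⟨hk, ?_⟩
      have hki : k ≠ i := by
        rintro rfl
        exact h1.ne' hy
      have hkj : k ≠ j := by
        rintro rfl
        exact (h1.trans h2).ne' hy
      rw [hagree k hki hkj, hy]
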